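/- arXiv:2111.10051 — 3 statements merged into one kernel-verified Lean document; each statement's English description precedes it below -/
import Mathlib

section
/- Spectral gap away from zero frequency (Lemma 3.2): For all real numbers 0 < r < R there exists b > 0 such that for every real η with r < |η| < R, every complex root λ of the cubic f(λ;η) = λ³ + λ²·η²(κθ_e + μ)/v + λ·(η²pp_e + η⁴κμθ_e/v² − η²p_v) − η⁴κθ_e p_v/v satisfies Re λ ≤ −b. -/
/-- The characteristic polynomial `f(λ;η)` of the matrix `-iηF'(Ū) - η²B(Ū)` of the
linearized compressible Navier–Stokes system, evaluated at `z`. -/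
noncomputable def charCubic (v μ κ θe p pe pv : ℝ) (η z : ℂ) : ℂ :=
  z ^ 3 + z ^ 2 * (η ^ 2 * ((κ : ℂ) * θe + μ) / v)
    + z * (η ^ 2 * (p : ℂ) * pe + η ^ 4 * (κ : ℂ) * μ * θe / (v : ℂ) ^ 2 - η ^ 2 * pv)
    - η ^ 4 * (κ : ℂ) * θe * pv / v


theorem real_cubic_bound (α q Q m m0 K b x : ℝ) (hα : 0 < α) (hq : 0 ≤ q) (hQ : 0 ≤ Q)
    (hm : 0 < m) (hm0 : m ≤ m0) (hK : α + Q ≤ K) (hb1 : b ≤ 1) (hbK : b * K ≤ m)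
    (hx : α * x ^ 3 + q * x ^ 2 + Q * x + m0 = 0) : x ≤ -b := by
  by_contra hlt
  push Not at hlt
  rcases le_or_gt 0 x with h0 | h0
  · have : 0 ≤ α * x ^ 3 + q * x ^ 2 + Q * x := by positivity
    linarith
  · obtain ⟨u, rfl⟩ : ∃ u, x = -u := ⟨-x, by ring⟩
    have hu : 0 < u := by linarith
    have hub : u < b := by linarith
    have h1 : m0 ≤ u * (α * u ^ 2 + Q) := by
      have : 0 ≤ q * u ^ 2 := by positivity
      nlinarith
    have h2 : u ^ 2 ≤ 1 := by nlinarith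
    have h3 : α * u ^ 2 + Q ≤ K := by nlinarith
    have h4 : u * (α * u ^ 2 + Q) ≤ u * K := mul_le_mul_of_nonneg_left h3 hu.le
    have h5 : u * K < b * K := mul_lt_mul_of_pos_right hub (by linarith)
    linarith

theorem complex_cubic_bound (A B C m K b : ℝ) (hA : 0 ≤ A) (hB : 0 ≤ B)
    (hm : 0 < m) (hC : m ≤ C) (hD : m ≤ A * B - C) (hK : 8 + 2 * (A ^ 2 + B) ≤ K)
    (hb1 : b ≤ 1) (hbK : b * K ≤ m) (l : ℂ)
    (hl : l ^ 3 + l ^ 2 * (A : ℂ) + l * (B : ℂ) + (C : ℂ) = 0) : l.re ≤ -b := by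
  obtain ⟨x, y⟩ := l
  have hre := congrArg Complex.re hl
  have him := congrArg Complex.im hl
  simp [pow_succ] at hre him
  have hi : y * (3 * x ^ 2 - y ^ 2 + 2 * A * x + B) = 0 := by linear_combination him
  show x ≤ -b
  rcases mul_eq_zero.mp hi with h | h
  · subst h
    exact real_cubic_bound 1 A B m C K b x one_pos hA hB hm hC (by nlinarith [sq_nonneg A])
      hb1 hbK (by linear_combination hre)
  · exact real_cubic_bound 8 (8 * A) (2 * (A ^ 2 + B)) m (A * B - C) K b x (by norm_num)
      (by positivity) (by positivity) hm hD hK hb1 hbK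
      (by linear_combination -hre + (3 * x + A) * h)

/-- Lemma 3.2: for real frequencies `η` with `r < |η| < R`, all roots of the characteristic
cubic have real part at most `-b` for some `b > 0`. -/
theorem spectral_gap_away_from_zero
    (v μ κ θe p pe pv : ℝ) (hv : 0 < v) (hμ : 0 < μ) (hκ : 0 < κ)
    (hθe : 0 < θe) (hp : 0 < p) (hpe : 0 < pe) (hpv : pv < 0) :
    ∀ r R : ℝ, 0 < r → r < R → ∃ b : ℝ, 0 < b ∧
      ∀ η : ℝ, r < |η| → |η| < R →
        ∀ l : ℂ, charCubic v μ κ θe p pe pv (η : ℂ) l = 0 → l.re ≤ -b := by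
  intro r R hr hrR
  set a := (κ * θe + μ) / v with ha
  set β := p * pe - pv with hβ
  set γ := κ * μ * θe / v ^ 2 with hγ
  set c := κ * θe * (-pv) / v with hc
  set d := (κ * θe + μ) / v * (p * pe) + μ * (-pv) / v with hd
  have hpv' : 0 < -pv := by linarith
  have ha0 : 0 < a := by positivity
  have hβ0 : 0 < β := by have := mul_pos hp hpe; linarith
  have hγ0 : 0 < γ := by positivity
  have hc0 : 0 < c := by positivity
  have hd0 : 0 < d := by positivity
  have hdeq : d = a * β - c := by rw [hd, ha, hβ, hc]; field_simp; ring
  clear_value d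
  set m := (r ^ 2) ^ 2 * min c d with hmdef
  have hm : 0 < m := by have := lt_min hc0 hd0; positivity
  set K := 8 + 2 * ((R ^ 2 * a) ^ 2 + (R ^ 2 * β + (R ^ 2) ^ 2 * γ)) with hKdef
  have hK : 0 < K := by positivity
  refine ⟨min 1 (m / K), by positivity, ?_⟩
  intro η h1 h2 l hl
  obtain ⟨t, ht⟩ : ∃ t, t = η ^ 2 := ⟨_, rfl⟩
  have hrt : r ^ 2 ≤ t := by rw [ht, ← sq_abs η]; gcongr
  have htR : t ≤ R ^ 2 := by rw [ht, ← sq_abs η]; gcongr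
  have ht0 : 0 < t := by have : 0 < r ^ 2 := by positivity
                         linarith
  refine complex_cubic_bound (t * a) (t * β + t ^ 2 * γ) (t ^ 2 * c) m K _ (by positivity)
    (by positivity) hm ?_ ?_ ?_ (min_le_left _ _) ?_ l ?_
  · have := min_le_left c d
    rw [hmdef]; gcongr
  · have h3 : m ≤ t ^ 2 * d := by
      have := min_le_right c d
      rw [hmdef]; gcongr
    have h4 : 0 ≤ t ^ 3 * a * γ := by positivity
    have h5 : t * a * (t * β + t ^ 2 * γ) - t ^ 2 * c = t ^ 2 * d + t ^ 3 * a * γ := by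
      rw [hdeq]; ring
    linarith
  · rw [hKdef]; gcongr
  · calc min 1 (m / K) * K ≤ m / K * K := by gcongr; exact min_le_right _ _
      _ = m := by field_simp
  · rw [← hl, charCubic, ht, ha, hβ, hγ, hc]
    push_cast
    ring
end

section
/- Properties of the approximate eigenvalues (Lemma 4.1, items (1) and (3)): Let α ≥ 0 and β, A₁, A₂, A₃ ∈ ℝ, and assume β < 0 in the case α = 0. Then there exist constants K > 0, σ₀ > 0 and σ* > 0 such that the function λ*(η) = −αη² + β + Σ_{k=1}^{3} A_k (1+η²)^{−k} − K (1+η²)^{−4} is holomorphic on the strip {η ∈ ℂ : |Im η| < σ₀}, and for every η in that strip one has Re( λ*(η) + (α/2)(η² + 1) ) ≤ −σ*. In particular, when α = 0 one has Re λ*(η) ≤ −σ* on the strip, and when α > 0 one has Re λ*(η) ≤ −σ* − (α/2) Re(η²+1) on the strip. (These are the analyticity and uniform negativity properties of the approximate eigenvalues λ_j* of the linearized Navier–Stokes system: λ₁* has α = 0 and β = v p_v/μ < 0; λ₂*, λ₃* have α = μ/v and α = κθ_e/v respectively.) -/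
/-- The approximate eigenvalue `λ*(η) = -αη² + β + ∑_{k=1}^{3} A_k(1+η²)^{-k} - K(1+η²)^{-4}`. -/
noncomputable def approxEigen (α β A₁ A₂ A₃ K : ℝ) (η : ℂ) : ℂ :=
  -(α : ℂ) * η ^ 2 + (β : ℂ) + (A₁ : ℂ) / (1 + η ^ 2) + (A₂ : ℂ) / (1 + η ^ 2) ^ 2
    + (A₃ : ℂ) / (1 + η ^ 2) ^ 3 - (K : ℂ) / (1 + η ^ 2) ^ 4

lemma scalar_choice (α β C : ℝ) (hα : 0 ≤ α) (hβ : α = 0 → β < 0) (hC : 0 ≤ C) :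
    ∃ u₀ δ : ℝ, 0 < u₀ ∧ 0 < δ ∧ ∀ u r : ℝ, 0 < u → u ≤ u₀ → u * r = 1 →
      -(α / 4) * r + α + β + C * u ≤ -δ := by
  rcases hα.eq_or_lt with h | h
  · have hb := hβ h.symm
    refine ⟨-β / (2 * (C + 1)), -β / 2, by apply div_pos <;> linarith, by linarith, ?_⟩
    intro u r hu hu0 hr
    rw [le_div_iff₀ (by positivity)] at hu0
    subst h
    nlinarith
  · refine ⟨min 1 (α / (4 * (|α + β| + C + 1))), 1, by positivity, one_pos, ?_⟩
    intro u r hu hu0 hr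
    have h1 : u ≤ 1 := hu0.trans (min_le_left _ _)
    have h2 := hu0.trans (min_le_right _ _)
    rw [le_div_iff₀ (by positivity)] at h2
    have hr0 : 0 < r := by
      by_contra hh
      nlinarith
    have h3 : |α + β| + C + 1 ≤ α / 4 * r := by
      have := mul_le_mul_of_nonneg_right h2 hr0.le
      have e : u * (4 * (|α + β| + C + 1)) * r = 4 * (|α + β| + C + 1) := by
        linear_combination (4 * (|α + β| + C + 1)) * hr
      rw [e] at this
      linarith
    have h4 := le_abs_self (α + β)
    nlinarith

lemma strip_re (η : ℂ) (h : |η.im| < 1 / 10) :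
    1 / 2 ≤ (1 + η ^ 2).re ∧ |(1 + η ^ 2).im| ≤ (1 + η ^ 2).re / 5 := by
  obtain ⟨x, y⟩ := η
  have e1 : (1 + (⟨x, y⟩ : ℂ) ^ 2).re = 1 + x ^ 2 - y ^ 2 := by
    simp [pow_two]; ring
  have e2 : (1 + (⟨x, y⟩ : ℂ) ^ 2).im = 2 * x * y := by
    simp [pow_two]; ring
  rw [e1, e2]
  simp only at h
  rw [abs_lt] at h
  have hy : y ^ 2 ≤ 1 / 100 := by nlinarith
  refine ⟨by nlinarith [sq_nonneg x], ?_⟩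
  rw [abs_le]
  constructor
  · nlinarith [sq_nonneg (x + 5 * y)]
  · nlinarith [sq_nonneg (x - 5 * y)]

lemma re_pow_four (v : ℂ) (h : |v.im| ≤ |v.re| / 5) : ‖v‖ ^ 4 / 2 ≤ (v ^ 4).re := by
  have e : ‖v‖ ^ 4 = (v.re ^ 2 + v.im ^ 2) ^ 2 := by
    rw [show ‖v‖ ^ 4 = (‖v‖ ^ 2) ^ 2 by ring, ← Complex.normSq_eq_norm_sq, Complex.normSq_apply]
    ring
  have e2 : (v ^ 4).re = v.re ^ 4 - 6 * v.re ^ 2 * v.im ^ 2 + v.im ^ 4 := by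
    simp [pow_succ]; ring
  have h2 : v.im ^ 2 ≤ v.re ^ 2 / 25 := by
    have := pow_le_pow_left₀ (abs_nonneg _) h 2
    rw [div_pow, sq_abs, sq_abs] at this
    linarith
  rw [e, e2]
  nlinarith [mul_le_mul_of_nonneg_left h2 (sq_nonneg v.re), sq_nonneg (v.re ^ 2),
    sq_nonneg (v.im ^ 2)]

lemma re_mul_pow_le (A : ℝ) (v : ℂ) (n : ℕ) : ((A : ℂ) * v ^ n).re ≤ |A| * ‖v‖ ^ n := by
  refine (Complex.re_le_norm _).trans ?_
  simp

/-- Lemma 4.1, items (1) and (3): for suitable `K > 0` the approximate eigenvalue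
`λ*` is holomorphic on a strip `|Im η| < σ₀` around the real axis, and on this strip
`Re(λ*(η) + (α/2)(η²+1)) ≤ -σ*` uniformly. -/
theorem approx_eigenvalue_properties (α β A₁ A₂ A₃ : ℝ) (hα : 0 ≤ α) (hβ : α = 0 → β < 0) :
    ∃ K σ₀ σs : ℝ, 0 < K ∧ 0 < σ₀ ∧ 0 < σs ∧
      DifferentiableOn ℂ (approxEigen α β A₁ A₂ A₃ K) {η : ℂ | |η.im| < σ₀} ∧
      ∀ η : ℂ, |η.im| < σ₀ →
        (approxEigen α β A₁ A₂ A₃ K η + ((α / 2 : ℝ) : ℂ) * (η ^ 2 + 1)).re ≤ -σs := by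
  have hC : 0 ≤ |A₁| + 2 * |A₂| + 4 * |A₃| := by positivity
  obtain ⟨u₀, δ, hu₀, hδ, H⟩ := scalar_choice α β _ hα hβ hC
  set C := |A₁| + 2 * |A₂| + 4 * |A₃| with hCdef
  set K := 2 * (|α + β| + 2 * C + δ) / u₀ ^ 4 with hK
  have hKpos : 0 < K := by positivity
  have hKu : K * u₀ ^ 4 = 2 * (|α + β| + 2 * C + δ) := by
    rw [hK]; field_simp
  refine ⟨K, 1 / 10, δ, hKpos, by norm_num, hδ, ?_, ?_⟩
  · intro η hη
    have hw : (1 + η ^ 2) ≠ 0 := by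
      intro h0
      have := (strip_re η hη).1
      rw [h0] at this
      norm_num at this
    apply DifferentiableAt.differentiableWithinAt
    unfold approxEigen
    fun_prop (disch := first | exact hw | exact pow_ne_zero _ hw)
  · intro η hη
    obtain ⟨h1, h2⟩ := strip_re η hη
    have e : approxEigen α β A₁ A₂ A₃ K η + ((α / 2 : ℝ) : ℂ) * (η ^ 2 + 1)
        = ((-(α / 2) : ℝ) : ℂ) * (1 + η ^ 2) + ((α + β : ℝ) : ℂ) + (A₁ : ℂ) * (1 + η ^ 2)⁻¹ ^ 1
          + (A₂ : ℂ) * (1 + η ^ 2)⁻¹ ^ 2 + (A₃ : ℂ) * (1 + η ^ 2)⁻¹ ^ 3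
          - (K : ℂ) * (1 + η ^ 2)⁻¹ ^ 4 := by
      unfold approxEigen
      simp only [div_eq_mul_inv, inv_pow, pow_one]
      push_cast
      ring
    rw [e]
    generalize 1 + η ^ 2 = w at h1 h2
    have hw : w ≠ 0 := by
      rintro rfl
      norm_num at h1
    have hr : 0 < ‖w‖ := norm_pos_iff.mpr hw
    have hrw : ‖w‖ ≤ 2 * w.re := by
      have := Complex.norm_le_abs_re_add_abs_im w
      rw [abs_of_pos (by linarith : 0 < w.re)] at this
      linarith
    have hrw' : 1 / 2 ≤ ‖w‖ := h1.trans (Complex.re_le_norm w)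
    have hu : 0 < ‖w⁻¹‖ := by simpa using hw
    have hur : ‖w⁻¹‖ * ‖w‖ = 1 := by
      rw [norm_inv]; field_simp
    have hu2 : ‖w⁻¹‖ ≤ 2 := by nlinarith
    have h4 : ‖w⁻¹‖ ^ 4 / 2 ≤ (w⁻¹ ^ 4).re := by
      apply re_pow_four
      rw [Complex.inv_re, Complex.inv_im, abs_div, abs_div, abs_neg, abs_of_pos (by linarith : 0 < w.re),
        div_right_comm]
      gcongr
    have a1 := re_mul_pow_le A₁ w⁻¹ 1
    have a2 := re_mul_pow_le A₂ w⁻¹ 2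
    have a3 := re_mul_pow_le A₃ w⁻¹ 3
    simp only [Complex.add_re, Complex.sub_re, Complex.re_ofReal_mul, Complex.ofReal_re] at a1 a2 a3 ⊢
    generalize ‖w⁻¹‖ = u at *
    have b1 : |A₁| * u ^ 1 + |A₂| * u ^ 2 + |A₃| * u ^ 3 ≤ C * u := by
      have c2 : u ^ 2 ≤ 2 * u := by nlinarith
      have c3 : u ^ 3 ≤ 4 * u := by nlinarith
      have := mul_le_mul_of_nonneg_left c2 (abs_nonneg A₂)
      have := mul_le_mul_of_nonneg_left c3 (abs_nonneg A₃)
      rw [hCdef]; linarith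
    have b4 := mul_le_mul_of_nonneg_left h4 hKpos.le
    have bα : α / 4 * ‖w‖ ≤ α / 2 * w.re := by nlinarith
    rcases le_total u u₀ with hc | hc
    · have := H u ‖w‖ hu hc hur
      have : 0 ≤ K * (u ^ 4 / 2) := by positivity
      linarith
    · have d1 : K * u₀ ^ 4 ≤ K * u ^ 4 := by gcongr
      have d2 := le_abs_self (α + β)
      have d3 : C * u ≤ C * 2 := by gcongr
      have d4 : 0 ≤ α / 4 * ‖w‖ := by positivity
      linarith
end

section
/- Weighted energy estimate for the regular part, short time (Lemma 4.7): Assume |v̄−1| + |ū| + |Ē−c_v| < ε with ε sufficiently small. Fix σ₀ > 0, σ₀* > 0 and C₀ > 0. Then there exist σ ∈ (0, σ₀) and C > 0 such that the following holds. Let Ψ : ℝ×[0,∞) → M₃(ℝ) be continuous with Σ_{k=0}^{4} |∂_x^k Ψ(x,t)| ≤ C₀ e^{−σ₀* t − σ₀|x|} for all x, t, and let V : ℝ×[0,∞) → M₃(ℝ) be a smooth solution of ∂_t V + F'(Ū) ∂_x V − B(Ū) ∂_x² V = −Ψ with V(x,0) = 0, such that V and its x-derivatives up to order 5 are bounded by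 C₀ e^{−σ₀|x|} uniformly for t in compact subsets of [0,∞). Then for all 0 < t < 1: ‖e^{σ|x|} V(·,t)‖_{H⁴(ℝ)} ≤ C t and Σ_{k=0}^{3} |∂_x^k V(x,t)| ≤ C t e^{−σ|x|} for all x ∈ ℝ. (Applied to V = G†, the regular part of the Green's function, with Ψ the truncation error, this is Lemma 4.7 of the paper.) -/
open MeasureTheory Matrix

/-- The flux Jacobian `F'(Ū)` of the conservative compressible Navier–Stokes system at the
constant state `Ū = (v̄, ū, Ē)`. -/
noncomputable def FluxJac (K cv vb ub Eb : ℝ) : Matrix (Fin 3) (Fin 3) ℝ :=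
  let θb := (Eb - ub ^ 2 / 2) / cv
  let pb := K * θb / vb
  let pv := -(K * θb) / vb ^ 2
  let pe := K / vb
  !![0, -1, 0; pv, -pe * ub, pe; pv * ub, pb - pe * ub ^ 2, pe * ub]

/-- The viscosity matrix `B(Ū)` of the conservative compressible Navier–Stokes system at
the constant state `Ū = (v̄, ū, Ē)`. -/
noncomputable def ViscMat (μ κ cv vb ub : ℝ) : Matrix (Fin 3) (Fin 3) ℝ :=
  let θe := 1 / cv
  !![0, 0, 0; 0, μ / vb, 0; 0, (μ / vb - κ * θe / vb) * ub, κ * θe / vb]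


lemma smooth_deriv_x (g : ℝ → ℝ → ℝ) (hg : ContDiff ℝ (⊤ : ℕ∞) (fun p : ℝ × ℝ => g p.1 p.2)) :
    ContDiff ℝ (⊤ : ℕ∞) (fun p : ℝ × ℝ => deriv (fun y => g y p.2) p.1) ∧
    ContDiff ℝ (⊤ : ℕ∞) (fun p : ℝ × ℝ => deriv (fun s => g p.1 s) p.2) ∧
    ∀ x t, deriv (fun s => deriv (fun y => g y s) x) t
      = deriv (fun y => deriv (fun s => g y s) t) x := by
  set G : ℝ × ℝ → ℝ := fun p => g p.1 p.2 with hG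
  have hd : Differentiable ℝ G := hg.differentiable (by simp)
  have hf : ContDiff ℝ (⊤ : ℕ∞) (fderiv ℝ G) := hg.fderiv_right (by simp)
  have hfd : Differentiable ℝ (fderiv ℝ G) := hf.differentiable (by simp)
  have cx : ∀ x t : ℝ, HasDerivAt (fun y : ℝ => (y, t)) ((1 : ℝ), (0 : ℝ)) x := fun x t =>
    (hasDerivAt_id x).prodMk (hasDerivAt_const x t)
  have ct : ∀ x t : ℝ, HasDerivAt (fun s : ℝ => (x, s)) ((0 : ℝ), (1 : ℝ)) t := fun x t =>
    (hasDerivAt_const t x).prodMk (hasDerivAt_id t)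
  have ex : ∀ x t, deriv (fun y => g y t) x = fderiv ℝ G (x, t) (1, 0) := fun x t => by
    have hh : HasFDerivAt G (fderiv ℝ G (x, t)) (x, t) := (hd (x, t)).hasFDerivAt
    exact (HasFDerivAt.comp_hasDerivAt (f := fun y : ℝ => (y, t)) x hh (cx x t)).deriv
  have et : ∀ x t, deriv (fun s => g x s) t = fderiv ℝ G (x, t) (0, 1) := fun x t => by
    have hh : HasFDerivAt G (fderiv ℝ G (x, t)) (x, t) := (hd (x, t)).hasFDerivAt
    exact (HasFDerivAt.comp_hasDerivAt (f := fun s : ℝ => (x, s)) t hh (ct x t)).deriv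
  refine ⟨?_, ?_, ?_⟩
  · simp only [ex]
    exact hf.clm_apply contDiff_const
  · simp only [et]
    exact hf.clm_apply contDiff_const
  · intro x t
    simp only [ex, et]
    have hh : HasFDerivAt (fderiv ℝ G) (fderiv ℝ (fderiv ℝ G) (x, t)) (x, t) :=
      (hfd (x, t)).hasFDerivAt
    have k1 : HasDerivAt (fun s : ℝ => fderiv ℝ G (x, s)) (fderiv ℝ (fderiv ℝ G) (x, t) (0, 1)) t :=
      HasFDerivAt.comp_hasDerivAt (f := fun s : ℝ => (x, s)) t hh (ct x t)
    have k2 : HasDerivAt (fun y : ℝ => fderiv ℝ G (y, t)) (fderiv ℝ (fderiv ℝ G) (x, t) (1, 0)) x :=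
      HasFDerivAt.comp_hasDerivAt (f := fun y : ℝ => (y, t)) x hh (cx x t)
    have h1 := (k1.clm_apply (hasDerivAt_const t ((1 : ℝ), (0 : ℝ)))).deriv
    have h2 := (k2.clm_apply (hasDerivAt_const x ((0 : ℝ), (1 : ℝ)))).deriv
    have hs : IsSymmSndFDerivAt ℝ G (x, t) :=
      hg.contDiffAt.isSymmSndFDerivAt (by
        rw [minSmoothness_of_isRCLikeNormedField]; exact WithTop.coe_le_coe.2 le_top)
    rw [h1, h2]
    simp only [map_zero, add_zero]
    exact hs _ _

lemma smooth_iter (g : ℝ → ℝ → ℝ) (hg : ContDiff ℝ (⊤ : ℕ∞) (fun p : ℝ × ℝ => g p.1 p.2))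
    (k : ℕ) :
    ContDiff ℝ (⊤ : ℕ∞) (fun p : ℝ × ℝ => iteratedDeriv k (fun y => g y p.2) p.1) ∧
    ∀ x t, deriv (fun s => iteratedDeriv k (fun y => g y s) x) t
      = iteratedDeriv k (fun y => deriv (fun s => g y s) t) x := by
  induction k with
  | zero => simpa using hg
  | succ k ih =>
    obtain ⟨h1, h2⟩ := ih
    obtain ⟨a, -, c⟩ := smooth_deriv_x (fun x t => iteratedDeriv k (fun y => g y t) x) h1
    simp only [iteratedDeriv_succ]
    refine ⟨a, fun x t => ?_⟩
    rw [show deriv (fun s => deriv (iteratedDeriv k fun y => g y s) x) t = _ from c x t]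
    simp only [h2]

lemma second_deriv_max (f f' : ℝ → ℝ) (f'' x : ℝ) (h1 : ∀ y, HasDerivAt f (f' y) y)
    (h2 : HasDerivAt f' f'' x) (hm : ∀ y, f y ≤ f x) : f'' ≤ 0 := by
  by_contra hlt
  push Not at hlt
  have hd : deriv f = f' := funext fun y => (h1 y).deriv
  have hmax : IsLocalMax f x := Filter.Eventually.of_forall hm
  have hmin : IsLocalMin f x := isLocalMin_of_deriv_deriv_pos (by rw [hd, h2.deriv]; exact hlt)
    hmax.deriv_eq_zero (h1 x).continuousAt
  have hc : f =ᶠ[nhds x] fun _ => f x := by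
    filter_upwards [hmin] with y hy using le_antisymm (hm y) hy
  have := hc.deriv.deriv.eq_of_nhds
  rw [hd, h2.deriv] at this
  simp at this
  linarith

lemma max_prin (u ut ux uxx : ℝ → ℝ → ℝ) (T a R : ℝ) (ha : 0 ≤ a)
    (hc : Continuous (fun p : ℝ × ℝ => u p.1 p.2))
    (h0 : ∀ x, u x 0 ≤ 0)
    (hR : ∀ x t, 0 ≤ t → t ≤ T → R ≤ |x| → u x t ≤ 0)
    (ht : ∀ x t, 0 < t → HasDerivAt (fun s => u x s) (ut x t) t)
    (hx : ∀ x t, 0 < t → HasDerivAt (fun y => u y t) (ux x t) x)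
    (hxx : ∀ x t, 0 < t → HasDerivAt (fun y => ux y t) (uxx x t) x)
    (hlt : ∀ x t, 0 < t → t ≤ T → ut x t < a * uxx x t) :
    ∀ x t, 0 ≤ t → t ≤ T → u x t ≤ 0 := by
  intro x t ht0 htT
  by_contra hpos
  push Not at hpos
  have hK : IsCompact (Set.Icc (-R) R ×ˢ Set.Icc (0 : ℝ) T) := isCompact_Icc.prod isCompact_Icc
  have hin : ∀ y s, 0 ≤ s → s ≤ T → 0 < u y s → (y, s) ∈ Set.Icc (-R) R ×ˢ Set.Icc (0 : ℝ) T := by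
    intro y s hs0 hsT hp
    have : |y| < R := by
      by_contra h
      exact absurd (hR y s hs0 hsT (not_lt.1 h)) (not_le.2 hp)
    exact ⟨⟨(abs_lt.1 this).1.le, (abs_lt.1 this).2.le⟩, hs0, hsT⟩
  obtain ⟨⟨y, s⟩, hys, hmax⟩ := hK.exists_isMaxOn ⟨_, hin x t ht0 htT hpos⟩ hc.continuousOn
  have hp : 0 < u y s := hpos.trans_le (hmax (hin x t ht0 htT hpos))
  have hall : ∀ z r, 0 ≤ r → r ≤ T → u z r ≤ u y s := by
    intro z r hr0 hrT
    by_cases h : 0 < u z r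
    · exact hmax (hin z r hr0 hrT h)
    · linarith
  have hsT := hys.2.2
  have hs : 0 < s := by
    rcases hys.2.1.eq_or_lt with h | h
    · simp only at h
      have := h0 y
      rw [h] at this
      linarith
    · exact h
  simp only at hsT
  have hA : uxx y s ≤ 0 := second_deriv_max _ _ _ _ (fun z => hx z s hs) (hxx y s hs)
    (fun z => hall z s hs.le hsT)
  have hB : 0 ≤ ut y s := by
    have := (ht y s hs).hasDerivWithinAt (s := Set.Iic s)
    by_contra hneg
    push Not at hneg
    have h3 := (hasDerivAt_iff_tendsto_slope.1 (ht y s hs)).eventually (gt_mem_nhds hneg)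
    have h4 : ∀ᶠ r in nhdsWithin s (Set.Iio s), slope (fun r => u y r) s r < 0 :=
      h3.filter_mono (nhdsWithin_mono _ (fun r hr => ne_of_lt hr))
    have h5 : ∀ᶠ r in nhdsWithin s (Set.Iio s), 0 < r :=
      (lt_mem_nhds hs).filter_mono nhdsWithin_le_nhds
    obtain ⟨r, hr1, hr2, hr3⟩ := (h4.and (h5.and self_mem_nhdsWithin)).exists
    have hr3 : r < s := hr3
    rw [slope_def_field] at hr1
    have := hall y r hr2.le (hr3.le.trans hsT)
    have : 0 ≤ (u y r - u y s) / (r - s) := div_nonneg_of_nonpos (by linarith) (by linarith)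
    linarith
  have := hlt y s hs hsT
  nlinarith [mul_nonneg ha (neg_nonneg.2 hA)]

lemma heat_upper (g gt gx gxx f : ℝ → ℝ → ℝ) (a s M C σ₀ : ℝ) (ha : 0 ≤ a) (hM : 0 ≤ M)
    (hσ : 0 < σ₀)
    (hc : Continuous (fun p : ℝ × ℝ => g p.1 p.2))
    (h0 : ∀ x, g x 0 = 0)
    (hdec : ∀ x t, 0 ≤ t → g x t ≤ C * Real.exp (-σ₀ * |x|))
    (ht : ∀ x t, 0 < t → HasDerivAt (fun s => g x s) (gt x t) t)
    (hx : ∀ x t, 0 < t → HasDerivAt (fun y => g y t) (gx x t) x)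
    (hxx : ∀ x t, 0 < t → HasDerivAt (fun y => gx y t) (gxx x t) x)
    (hpde : ∀ x t, 0 < t → gt x t = a * gxx x t + f x t)
    (hf : ∀ x t, 0 < t → f x t ≤ M * Real.exp (s * x)) (x t : ℝ) (ht0 : 0 ≤ t) (ht1 : t ≤ 1) :
    g x t ≤ M * t * Real.exp (a * s ^ 2 * t) * Real.exp (s * x) := by
  refine le_of_forall_pos_le_add fun δ' hδ' => ?_
  obtain ⟨δ, hδ, hδe⟩ : ∃ δ : ℝ, 0 < δ ∧ δ * (1 + 1) = δ' := ⟨δ' / 2, by positivity, by ring⟩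
  have key := max_prin
    (fun x t => g x t - M * t * Real.exp (a * s ^ 2 * t) * Real.exp (s * x) - δ * (1 + t))
    (fun x t => gt x t - (M * Real.exp (a * s ^ 2 * t) * Real.exp (s * x)
      + M * t * (Real.exp (a * s ^ 2 * t) * (a * s ^ 2)) * Real.exp (s * x)) - δ)
    (fun x t => gx x t - M * t * Real.exp (a * s ^ 2 * t) * (Real.exp (s * x) * s))
    (fun x t => gxx x t - M * t * Real.exp (a * s ^ 2 * t) * (Real.exp (s * x) * s * s))
    1 a (|C| / (δ * σ₀)) ha (by fun_prop) ?_ ?_ ?_ ?_ ?_ ?_ x t ht0 ht1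
  · nlinarith
  · intro x
    simp [h0]
    exact hδ.le
  · intro y r hr0 hr1 hy
    have h1 := hdec y r hr0
    have h2 : C * Real.exp (-σ₀ * |y|) ≤ δ := by
      rw [neg_mul, Real.exp_neg, ← div_eq_mul_inv, div_le_iff₀ (Real.exp_pos _)]
      have h3 := Real.add_one_le_exp (σ₀ * |y|)
      rw [div_le_iff₀ (by positivity)] at hy
      have := le_abs_self C
      nlinarith
    have h3 : 0 ≤ M * r * Real.exp (a * s ^ 2 * r) * Real.exp (s * y) := by positivity
    have h4 : 0 ≤ δ * r := by positivity
    linarith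
  · intro y r hr
    have e1 : HasDerivAt (fun r : ℝ => Real.exp (a * s ^ 2 * r))
        (Real.exp (a * s ^ 2 * r) * (a * s ^ 2)) r := by
      simpa using ((hasDerivAt_id r).const_mul (a * s ^ 2)).exp
    have e2 : HasDerivAt (fun r : ℝ => M * r) M r := by
      simpa using (hasDerivAt_id r).const_mul M
    have e3 : HasDerivAt (fun r : ℝ => δ * (1 + r)) δ r := by
      simpa using ((hasDerivAt_id r).const_add 1).const_mul δ
    refine (((ht y r hr).sub ((e2.mul e1).mul_const (Real.exp (s * y)))).sub e3).congr_deriv ?_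
    ring
  · intro y r hr
    have e1 : HasDerivAt (fun y : ℝ => Real.exp (s * y)) (Real.exp (s * y) * s) y := by
      simpa using ((hasDerivAt_id y).const_mul s).exp
    exact ((hx y r hr).sub (e1.const_mul _)).sub_const _
  · intro y r hr
    have e1 : HasDerivAt (fun y : ℝ => Real.exp (s * y)) (Real.exp (s * y) * s) y := by
      simpa using ((hasDerivAt_id y).const_mul s).exp
    exact (hxx y r hr).sub ((e1.mul_const s).const_mul _)
  · intro y r hr hr1
    rw [hpde y r hr]
    have h1 := hf y r hr
    have h2 : 1 ≤ Real.exp (a * s ^ 2 * r) := Real.one_le_exp (by positivity)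
    have h3 : 0 ≤ M * Real.exp (s * y) := by positivity
    nlinarith [mul_le_mul_of_nonneg_left h2 h3]

lemma heat_abs (g f : ℝ → ℝ → ℝ) (a M C σ₀ : ℝ) (ha : 0 ≤ a) (hM : 0 ≤ M)
    (hσ : 0 < σ₀)
    (hc : ContDiff ℝ (⊤ : ℕ∞) (fun p : ℝ × ℝ => g p.1 p.2))
    (h0 : ∀ x, g x 0 = 0)
    (hdec : ∀ x t, 0 ≤ t → |g x t| ≤ C * Real.exp (-σ₀ * |x|))
    (hpde : ∀ x t, 0 < t → deriv (fun s => g x s) t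
      = a * deriv (fun z => deriv (fun y => g y t) z) x + f x t)
    (hf : ∀ x t, 0 < t → |f x t| ≤ M * Real.exp (-σ₀ * |x|)) (x t : ℝ) (ht0 : 0 ≤ t)
    (ht1 : t ≤ 1) :
    |g x t| ≤ M * Real.exp (a * σ₀ ^ 2) * t * Real.exp (-σ₀ * |x|) := by
  have ht : ∀ x t, HasDerivAt (fun s => g x s) (deriv (fun s => g x s) t) t := fun x t => by
    have : ContDiff ℝ (⊤ : ℕ∞) (fun s => g x s) := hc.comp (contDiff_const.prodMk contDiff_id)
    exact (this.differentiable (by simp) t).hasDerivAt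
  have hx : ∀ x t, HasDerivAt (fun y => g y t) (deriv (fun y => g y t) x) x := fun x t => by
    have : ContDiff ℝ (⊤ : ℕ∞) (fun y => g y t) := hc.comp (contDiff_id.prodMk contDiff_const)
    exact (this.differentiable (by simp) x).hasDerivAt
  have hxx : ∀ x t, HasDerivAt (fun z => deriv (fun y => g y t) z)
      (deriv (fun z => deriv (fun y => g y t) z) x) x := fun x t => by
    have : ContDiff ℝ (⊤ : ℕ∞) (fun z => deriv (fun y => g y t) z) :=
      (smooth_deriv_x g hc).1.comp (contDiff_id.prodMk contDiff_const)
    exact (this.differentiable (by simp) x).hasDerivAt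
  have main : ∀ s : ℝ, s ^ 2 = σ₀ ^ 2 → (∀ x, -σ₀ * |x| ≤ s * x) → ∀ x,
      |g x t| ≤ M * t * Real.exp (a * s ^ 2 * t) * Real.exp (s * x) := by
    intro s hs hsx x
    have hle : ∀ x t, 0 < t → |f x t| ≤ M * Real.exp (s * x) := fun x t h =>
      (hf x t h).trans (mul_le_mul_of_nonneg_left (Real.exp_le_exp.2 (hsx x)) hM)
    rw [abs_le']
    constructor
    · exact heat_upper g _ _ _ f a s M C σ₀ ha hM hσ hc.continuous h0
        (fun x t h => (le_abs_self _).trans (hdec x t h))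
        (fun x t _ => ht x t) (fun x t _ => hx x t) (fun x t _ => hxx x t) hpde
        (fun x t h => (le_abs_self _).trans (hle x t h)) x t ht0 ht1
    · refine heat_upper (fun x t => - g x t) _ _ _ (fun x t => - f x t) a s M C σ₀ ha hM hσ
        hc.continuous.neg (fun x => by simp [h0])
        (fun x t h => (neg_le_abs _).trans (hdec x t h))
        (fun x t _ => (ht x t).neg) (fun x t _ => (hx x t).neg) (fun x t _ => (hxx x t).neg) ?_
        (fun x t h => (neg_le_abs _).trans (hle x t h)) x t ht0 ht1
      intro x t h
      rw [hpde x t h]; ring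
  have fin : ∀ s : ℝ, s ^ 2 = σ₀ ^ 2 → s * x = -σ₀ * |x| → (∀ x, -σ₀ * |x| ≤ s * x) →
      |g x t| ≤ M * Real.exp (a * σ₀ ^ 2) * t * Real.exp (-σ₀ * |x|) := by
    intro s hs hsx hall
    refine (main s hs hall x).trans ?_
    rw [hsx, hs]
    have : Real.exp (a * σ₀ ^ 2 * t) ≤ Real.exp (a * σ₀ ^ 2) := by
      apply Real.exp_le_exp.2
      have : 0 ≤ a * σ₀ ^ 2 := by positivity
      nlinarith
    calc M * t * Real.exp (a * σ₀ ^ 2 * t) * Real.exp (-σ₀ * |x|)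
        ≤ M * t * Real.exp (a * σ₀ ^ 2) * Real.exp (-σ₀ * |x|) := by gcongr
      _ = _ := by ring
  rcases le_total 0 x with h | h
  · refine fin (-σ₀) (by ring) (by rw [abs_of_nonneg h]) fun y => ?_
    nlinarith [le_abs_self y]
  · refine fin σ₀ rfl (by rw [abs_of_nonpos h]; ring) fun y => ?_
    nlinarith [neg_abs_le y]

lemma slice_smooth (g : ℝ → ℝ → ℝ) (hg : ContDiff ℝ (⊤ : ℕ∞) (fun p : ℝ × ℝ => g p.1 p.2))
    (t : ℝ) : ContDiff ℝ (⊤ : ℕ∞) (fun y => g y t) :=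
  hg.comp (contDiff_id.prodMk contDiff_const)

lemma derived_pde (F B : Matrix (Fin 3) (Fin 3) ℝ) (Ψ V : ℝ → ℝ → Matrix (Fin 3) (Fin 3) ℝ)
    (hΨ : ∀ i j : Fin 3, ∀ t : ℝ, ContDiff ℝ 4 (fun x => Ψ x t i j))
    (hV : ∀ i j : Fin 3, ContDiff ℝ (⊤ : ℕ∞) (fun p : ℝ × ℝ => V p.1 p.2 i j))
    (hpde : ∀ i j : Fin 3, ∀ x t : ℝ, 0 < t →
            deriv (fun s => V x s i j) t
              + (∑ k : Fin 3, F i k * deriv (fun y => V y t k j) x)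
              - (∑ k : Fin 3, B i k
                  * iteratedDeriv 2 (fun y => V y t k j) x)
            = -Ψ x t i j) (n : ℕ) (hn : n ≤ 4) (i j : Fin 3) (x t : ℝ) (ht : 0 < t) :
    deriv (fun s => iteratedDeriv n (fun y => V y s i j) x) t =
      (∑ k : Fin 3, B i k * iteratedDeriv (n + 2) (fun y => V y t k j) x)
      + -((∑ k : Fin 3, F i k * iteratedDeriv (n + 1) (fun y => V y t k j) x)
      + iteratedDeriv n (fun y => Ψ y t i j) x) := by
  rw [(smooth_iter (fun x t => V x t i j) (hV i j) n).2 x t]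
  have e : (fun y => deriv (fun s => V y s i j) t) = fun y =>
      (∑ k : Fin 3, B i k * iteratedDeriv 2 (fun y => V y t k j) y)
      + -((∑ k : Fin 3, F i k * iteratedDeriv 1 (fun y => V y t k j) y) + Ψ y t i j) := by
    funext y
    have := hpde i j y t ht
    simp only [iteratedDeriv_one]
    linarith
  have sm : ∀ m : ℕ, ∀ k : Fin 3, ContDiffAt ℝ n (fun y => iteratedDeriv m (fun y => V y t k j) y) x :=
    fun m k => (contDiff_infty.1
      (slice_smooth (fun x t => iteratedDeriv m (fun y => V y t k j) x)
        (smooth_iter (fun x t => V x t k j) (hV k j) m).1 t) n).contDiffAt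
  have it : ∀ m : ℕ, ∀ k : Fin 3, iteratedDeriv n (fun y => iteratedDeriv m (fun y => V y t k j) y) x
      = iteratedDeriv (n + m) (fun y => V y t k j) x := by
    intro m k
    simp only [iteratedDeriv_eq_iterate, Function.iterate_add_apply]
  have hp : ContDiffAt ℝ n (fun y => Ψ y t i j) x :=
    ((hΨ i j t).of_le (by exact_mod_cast hn)).contDiffAt
  have sB : ContDiffAt ℝ n
      (fun y => ∑ k : Fin 3, B i k * iteratedDeriv 2 (fun y => V y t k j) y) x :=
    ContDiffAt.sum fun k _ => contDiffAt_const.mul (sm 2 k)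
  have sF : ContDiffAt ℝ n
      (fun y => ∑ k : Fin 3, F i k * iteratedDeriv 1 (fun y => V y t k j) y) x :=
    ContDiffAt.sum fun k _ => contDiffAt_const.mul (sm 1 k)
  rw [e, iteratedDeriv_fun_add sB (sF.add hp).neg, iteratedDeriv_fun_neg,
    iteratedDeriv_fun_add sF hp,
    iteratedDeriv_fun_sum (fun k _ => contDiffAt_const.mul (sm 2 k)),
    iteratedDeriv_fun_sum (fun k _ => contDiffAt_const.mul (sm 1 k))]
  simp only [iteratedDeriv_const_mul_field, it]

lemma integrable_exp_abs (σ : ℝ) (hσ : 0 < σ) : Integrable (fun x : ℝ => Real.exp (-σ * |x|)) := by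
  rw [← integrableOn_univ, ← Set.Iic_union_Ioi (a := (0 : ℝ)), integrableOn_union]
  constructor
  · refine (integrableOn_exp_mul_Iic hσ 0).congr_fun (fun x hx => ?_) measurableSet_Iic
    simp only [abs_of_nonpos (Set.mem_Iic.1 hx)]
    ring_nf
  · refine (integrableOn_exp_mul_Ioi (neg_neg_of_pos hσ) 0).congr_fun (fun x hx => ?_)
      measurableSet_Ioi
    simp only [abs_of_pos (Set.mem_Ioi.1 hx)]

lemma pointwise_bound (μ κ K cv : ℝ) (hμ : 0 < μ) (hκ : 0 < κ) (hcv : 0 < cv)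
    (vb ub Eb : ℝ) (hvb : 0 < vb) (σ₀ σs C₀ : ℝ) (hσ : 0 < σ₀) (hσs : 0 < σs) (hC₀ : 0 < C₀) :
    ∃ C : ℝ, 0 < C ∧ ∀ Ψ V : ℝ → ℝ → Matrix (Fin 3) (Fin 3) ℝ,
          (∀ i j : Fin 3, ∀ t : ℝ, ContDiff ℝ 4 (fun x => Ψ x t i j)) →
          (∀ i j : Fin 3, ∀ k : ℕ, k ≤ 4 → ∀ x t : ℝ, 0 ≤ t →
            |iteratedDeriv k (fun y => Ψ y t i j) x|
              ≤ C₀ * Real.exp (-σs * t - σ₀ * |x|)) →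
          (∀ i j : Fin 3, ContDiff ℝ (⊤ : ℕ∞) (fun p : ℝ × ℝ => V p.1 p.2 i j)) →
          (∀ x : ℝ, V x 0 = 0) →
          (∀ i j : Fin 3, ∀ x t : ℝ, 0 < t →
            deriv (fun s => V x s i j) t
              + (∑ k : Fin 3, FluxJac K cv vb ub Eb i k * deriv (fun y => V y t k j) x)
              - (∑ k : Fin 3, ViscMat μ κ cv vb ub i k
                  * iteratedDeriv 2 (fun y => V y t k j) x)
            = -Ψ x t i j) →
          (∀ i j : Fin 3, ∀ k : ℕ, k ≤ 5 → ∀ x t : ℝ, 0 ≤ t →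
            |iteratedDeriv k (fun y => V y t i j) x| ≤ C₀ * Real.exp (-σ₀ * |x|)) →
          ∀ (i j : Fin 3) (n : ℕ), n ≤ 4 → ∀ x t : ℝ, 0 < t → t < 1 →
            |iteratedDeriv n (fun y => V y t i j) x| ≤ C * t * Real.exp (-σ₀ * |x|) := by
  set F := FluxJac K cv vb ub Eb with hF
  set B := ViscMat μ κ cv vb ub with hB
  set A : ℝ := ∑ i : Fin 3, ∑ k : Fin 3, |F i k| with hA
  set a1 : ℝ := μ / vb with ha1
  set a2 : ℝ := κ * (1 / cv) / vb with ha2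
  have pa1 : 0 < a1 := by positivity
  have pa2 : 0 < a2 := by positivity
  have hA0 : 0 ≤ A := by positivity
  have hu : 0 ≤ |ub| := abs_nonneg ub
  set M : ℝ := (1 + |ub|) * ((A + 1) * C₀) with hM
  have hM0 : 0 < M := by positivity
  set E : ℝ := Real.exp ((a1 + a2) * σ₀ ^ 2) with hE
  refine ⟨(1 + |ub|) * (M * E), by positivity, ?_⟩
  intro Ψ V hΨs hΨ hV hV0 hpde hdec i j n hn x t ht0 ht1
  have D := fun i x t => derived_pde F B Ψ V hΨs hV hpde n hn i j x t
  -- the source terms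
  set S : Fin 3 → ℝ → ℝ → ℝ := fun i x t =>
    -((∑ k : Fin 3, F i k * iteratedDeriv (n + 1) (fun y => V y t k j) x)
      + iteratedDeriv n (fun y => Ψ y t i j) x) with hS
  have hSb : ∀ i x t, 0 < t → |S i x t| ≤ (A + 1) * C₀ * Real.exp (-σ₀ * |x|) := by
    intro i x t ht
    have h1 : |iteratedDeriv n (fun y => Ψ y t i j) x| ≤ C₀ * Real.exp (-σ₀ * |x|) := by
      refine (hΨ i j n hn x t ht.le).trans ?_
      gcongr
      nlinarith
    have h2 : |∑ k : Fin 3, F i k * iteratedDeriv (n + 1) (fun y => V y t k j) x|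
        ≤ A * (C₀ * Real.exp (-σ₀ * |x|)) := by
      refine (Finset.abs_sum_le_sum_abs _ _).trans ?_
      calc ∑ k : Fin 3, |F i k * iteratedDeriv (n + 1) (fun y => V y t k j) x|
          ≤ ∑ k : Fin 3, |F i k| * (C₀ * Real.exp (-σ₀ * |x|)) := by
            refine Finset.sum_le_sum fun k _ => ?_
            rw [abs_mul]
            exact mul_le_mul_of_nonneg_left (hdec k j (n + 1) (by omega) x t ht.le) (abs_nonneg _)
        _ = (∑ k : Fin 3, |F i k|) * (C₀ * Real.exp (-σ₀ * |x|)) := by rw [Finset.sum_mul]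
        _ ≤ A * (C₀ * Real.exp (-σ₀ * |x|)) := by
            refine mul_le_mul_of_nonneg_right ?_ (by positivity)
            exact Finset.single_le_sum (f := fun i : Fin 3 => ∑ k : Fin 3, |F i k|)
              (fun i _ => Finset.sum_nonneg fun k _ => abs_nonneg _) (Finset.mem_univ i)
    simp only [hS, abs_neg]
    refine (abs_add_le _ _).trans ?_
    linarith
  have hSM : ∀ i x t, 0 < t → |S i x t| ≤ M * Real.exp (-σ₀ * |x|) := by
    intro i x t ht
    refine (hSb i x t ht).trans ?_
    refine mul_le_mul_of_nonneg_right ?_ (Real.exp_pos _).le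
    have : 0 ≤ |ub| * ((A + 1) * C₀) := by positivity
    rw [hM]; linarith
  have sm : ∀ i, ContDiff ℝ (⊤ : ℕ∞)
      (fun p : ℝ × ℝ => iteratedDeriv n (fun y => V y p.2 i j) p.1) := fun i =>
    (smooth_iter (fun x t => V x t i j) (hV i j) n).1
  have z0 : ∀ i x, iteratedDeriv n (fun y => V y 0 i j) x = 0 := by
    intro i x
    have : (fun y => V y 0 i j) = fun _ => (0 : ℝ) := by
      funext y; rw [hV0 y]; rfl
    rw [this, iteratedDeriv_const]
    simp
  have dd : ∀ i x t, deriv (fun z => deriv (fun y => iteratedDeriv n (fun y => V y t i j) y) z) x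
      = iteratedDeriv (n + 2) (fun y => V y t i j) x := by
    intro i x t
    rw [iteratedDeriv_succ, iteratedDeriv_succ]
  have dec : ∀ i x t, 0 ≤ t → |iteratedDeriv n (fun y => V y t i j) x|
      ≤ C₀ * Real.exp (-σ₀ * |x|) := fun i x t h => hdec i j n (by omega) x t h
  have enl : ∀ a, 0 ≤ a → a ≤ a1 + a2 → ∀ w x : ℝ,
      |w| ≤ M * Real.exp (a * σ₀ ^ 2) * t * Real.exp (-σ₀ * |x|) →
      |w| ≤ M * E * t * Real.exp (-σ₀ * |x|) := by
    intro a _ ha w x hw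
    refine hw.trans ?_
    rw [hE]
    gcongr
  have R0 : |iteratedDeriv n (fun y => V y t 0 j) x| ≤ M * E * t * Real.exp (-σ₀ * |x|) := by
    refine enl 0 le_rfl (by positivity) _ x ?_
    refine heat_abs (fun x t => iteratedDeriv n (fun y => V y t 0 j) x) (S 0) 0 M C₀ σ₀ le_rfl
      hM0.le hσ (sm 0) (z0 0) (dec 0) ?_ (hSM 0) x t ht0.le ht1.le
    intro x t ht
    rw [dd, D 0 x t ht]
    simp [hB, ViscMat, Fin.sum_univ_three, hS]
  have R1 : |iteratedDeriv n (fun y => V y t 1 j) x| ≤ M * E * t * Real.exp (-σ₀ * |x|) := by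
    refine enl a1 pa1.le (by linarith) _ x ?_
    refine heat_abs (fun x t => iteratedDeriv n (fun y => V y t 1 j) x) (S 1) a1 M C₀ σ₀ pa1.le
      hM0.le hσ (sm 1) (z0 1) (dec 1) ?_ (hSM 1) x t ht0.le ht1.le
    intro x t ht
    rw [dd, D 1 x t ht]
    congr 1
    simp [hB, ViscMat, Fin.sum_univ_three, ha1]
  have sl : ∀ i t, ContDiff ℝ (⊤ : ℕ∞) (fun y => iteratedDeriv n (fun y => V y t i j) y) :=
    fun i t => slice_smooth (fun x t => iteratedDeriv n (fun y => V y t i j) x) (sm i) t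
  have slt : ∀ i x, ContDiff ℝ (⊤ : ℕ∞) (fun t => iteratedDeriv n (fun y => V y t i j) x) :=
    fun i x => (sm i).comp (contDiff_const.prodMk contDiff_id)
  have sl1 : ∀ i t, ContDiff ℝ (⊤ : ℕ∞)
      (fun z => deriv (fun y => iteratedDeriv n (fun y => V y t i j) y) z) :=
    fun i t => slice_smooth
      (fun x t => deriv (fun y => iteratedDeriv n (fun y => V y t i j) y) x)
      (smooth_deriv_x (fun x t => iteratedDeriv n (fun y => V y t i j) x) (sm i)).1 t
  have lin : ∀ f g : ℝ → ℝ, ContDiff ℝ (⊤ : ℕ∞) f → ContDiff ℝ (⊤ : ℕ∞) g → ∀ x,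
      deriv (fun y => f y - ub * g y) x = deriv f x - ub * deriv g x := by
    intro f g hf hg x
    have h1 := (hf.differentiable (by simp) x).hasDerivAt
    have h2 := (hg.differentiable (by simp) x).hasDerivAt
    exact (h1.sub (h2.const_mul ub)).deriv
  have comb : ∀ p q c : ℝ, |p| ≤ c → |q| ≤ c → |p - ub * q| ≤ (1 + |ub|) * c := by
    intro p q c hp hq
    refine (abs_sub _ _).trans ?_
    rw [abs_mul]
    nlinarith
  have R2 : |iteratedDeriv n (fun y => V y t 2 j) x - ub * iteratedDeriv n (fun y => V y t 1 j) x|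
      ≤ M * E * t * Real.exp (-σ₀ * |x|) := by
    refine enl a2 pa2.le (by linarith) _ x ?_
    refine heat_abs (fun x t => iteratedDeriv n (fun y => V y t 2 j) x
        - ub * iteratedDeriv n (fun y => V y t 1 j) x)
      (fun x t => S 2 x t - ub * S 1 x t) a2 M ((1 + |ub|) * C₀) σ₀ pa2.le
      hM0.le hσ ((sm 2).sub (contDiff_const.mul (sm 1))) (fun x => by simp [z0])
      (fun x t h => ?_) ?_ (fun x t h => ?_) x t ht0.le ht1.le
    · have := comb _ _ _ (dec 2 x t h) (dec 1 x t h)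
      linarith
    · intro x t ht
      simp only [lin _ _ (sl 2 t) (sl 1 t)]
      rw [lin _ _ (slt 2 x) (slt 1 x), lin _ _ (sl1 2 t) (sl1 1 t), dd, dd, D 2 x t ht, D 1 x t ht]
      simp only [hS]
      simp [hB, ViscMat, Fin.sum_univ_three, ha2]
      ring
    · have := comb _ _ _ (hSb 2 x t h) (hSb 1 x t h)
      rw [hM]
      linarith
  have hpos : 0 ≤ M * E * t * Real.exp (-σ₀ * |x|) := by positivity
  have hpos2 := mul_nonneg hu hpos
  have tgt : (1 + |ub|) * (M * E) * t * Real.exp (-σ₀ * |x|)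
      = M * E * t * Real.exp (-σ₀ * |x|) + |ub| * (M * E * t * Real.exp (-σ₀ * |x|)) := by ring
  rw [tgt]
  fin_cases i
  · show |iteratedDeriv n (fun y => V y t 0 j) x| ≤ _
    linarith
  · show |iteratedDeriv n (fun y => V y t 1 j) x| ≤ _
    linarith
  · show |iteratedDeriv n (fun y => V y t 2 j) x| ≤ _
    have h1 : |ub * iteratedDeriv n (fun y => V y t 1 j) x|
        ≤ |ub| * (M * E * t * Real.exp (-σ₀ * |x|)) := by
      rw [abs_mul]; exact mul_le_mul_of_nonneg_left R1 hu
    have h2 := abs_add_le (iteratedDeriv n (fun y => V y t 2 j) x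
      - ub * iteratedDeriv n (fun y => V y t 1 j) x) (ub * iteratedDeriv n (fun y => V y t 1 j) x)
    rw [sub_add_cancel] at h2
    linarith

/-- Lemma 4.7 (weighted energy estimate for the regular part, short time): any smooth,
exponentially localized solution `V` of `V_t + F'(Ū)V_x - B(Ū)V_{xx} = -Ψ` with `V(·,0) = 0`
and exponentially localized source `Ψ` satisfies `‖e^{σ|x|}V(·,t)‖_{H⁴} ≤ Ct` and the
pointwise bound `∑_{k≤3}|∂_x^k V(x,t)| ≤ Cte^{-σ|x|}` for `0 < t < 1`. -/
theorem regular_part_energy_short_time (μ κ K cv : ℝ)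
    (hμ : 0 < μ) (hκ : 0 < κ) (hK : 0 < K) (hcv : 0 < cv) :
    ∃ ε : ℝ, 0 < ε ∧ ∀ vb ub Eb : ℝ, 0 < vb →
      |vb - 1| + |ub| + |Eb - cv| < ε →
      ∀ σ₀ σs C₀ : ℝ, 0 < σ₀ → 0 < σs → 0 < C₀ →
      ∃ σ C : ℝ, 0 < σ ∧ σ < σ₀ ∧ 0 < C ∧
        ∀ Ψ V : ℝ → ℝ → Matrix (Fin 3) (Fin 3) ℝ,
          Continuous (fun p : ℝ × ℝ => Ψ p.1 p.2) →
          (∀ i j : Fin 3, ∀ t : ℝ, ContDiff ℝ 4 (fun x => Ψ x t i j)) →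
          (∀ i j : Fin 3, ∀ k : ℕ, k ≤ 4 → ∀ x t : ℝ, 0 ≤ t →
            |iteratedDeriv k (fun y => Ψ y t i j) x|
              ≤ C₀ * Real.exp (-σs * t - σ₀ * |x|)) →
          (∀ i j : Fin 3, ContDiff ℝ (⊤ : ℕ∞) (fun p : ℝ × ℝ => V p.1 p.2 i j)) →
          (∀ x : ℝ, V x 0 = 0) →
          -- the linearized PDE, entrywise
          (∀ i j : Fin 3, ∀ x t : ℝ, 0 < t →
            deriv (fun s => V x s i j) t
              + (∑ k : Fin 3, FluxJac K cv vb ub Eb i k * deriv (fun y => V y t k j) x)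
              - (∑ k : Fin 3, ViscMat μ κ cv vb ub i k
                  * iteratedDeriv 2 (fun y => V y t k j) x)
            = -Ψ x t i j) →
          -- exponential localization of V and its x-derivatives up to order 5
          (∀ i j : Fin 3, ∀ k : ℕ, k ≤ 5 → ∀ x t : ℝ, 0 ≤ t →
            |iteratedDeriv k (fun y => V y t i j) x| ≤ C₀ * Real.exp (-σ₀ * |x|)) →
          ∀ t : ℝ, 0 < t → t < 1 →
            (Real.sqrt (∑ i : Fin 3, ∑ j : Fin 3, ∑ k ∈ Finset.range 5,
                ∫ x : ℝ, Real.exp (2 * σ * |x|)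
                  * (iteratedDeriv k (fun y => V y t i j) x) ^ 2)
              ≤ C * t) ∧
            ∀ x : ℝ, (∑ i : Fin 3, ∑ j : Fin 3, ∑ k ∈ Finset.range 4,
                |iteratedDeriv k (fun y => V y t i j) x|)
              ≤ C * t * Real.exp (-σ * |x|) := by
  refine ⟨1, one_pos, ?_⟩
  intro vb ub Eb hvb _ σ₀ σs C₀ hσ hσs hC₀
  obtain ⟨C, hC, H⟩ := pointwise_bound μ κ K cv hμ hκ hcv vb ub Eb hvb σ₀ σs C₀ hσ hσs hC₀
  set J : ℝ := ∫ x : ℝ, Real.exp (-σ₀ * |x|) with hJ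
  have hJ0 : 0 ≤ J := integral_nonneg fun x => (Real.exp_pos _).le
  refine ⟨σ₀ / 2, 36 * C + Real.sqrt (45 * J) * C, by positivity, by linarith, by positivity, ?_⟩
  intro Ψ V _ hΨs hΨ hV hV0 hpde hdec t ht0 ht1
  have P := fun i j n hn x => H Ψ V hΨs hΨ hV hV0 hpde hdec i j n hn x t ht0 ht1
  constructor
  · have hI : ∀ i j : Fin 3, ∀ k ∈ Finset.range 5,
        ∫ x : ℝ, Real.exp (2 * (σ₀ / 2) * |x|) * (iteratedDeriv k (fun y => V y t i j) x) ^ 2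
          ≤ (C * t) ^ 2 * J := by
      intro i j k hk
      rw [hJ, ← integral_const_mul]
      refine integral_mono_of_nonneg (Filter.Eventually.of_forall fun x => by positivity)
        ((integrable_exp_abs σ₀ hσ).const_mul _) (Filter.Eventually.of_forall fun x => ?_)
      have h1 := P i j k (by have := Finset.mem_range.1 hk; omega) x
      have h2 : (iteratedDeriv k (fun y => V y t i j) x) ^ 2
          ≤ (C * t * Real.exp (-σ₀ * |x|)) ^ 2 := by
        rw [← sq_abs]
        exact pow_le_pow_left₀ (abs_nonneg _) h1 2
      have h3 : Real.exp (2 * (σ₀ / 2) * |x|) * Real.exp (-σ₀ * |x|) = 1 := by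
        rw [← Real.exp_add, ← Real.exp_zero]; congr 1; ring
      calc Real.exp (2 * (σ₀ / 2) * |x|) * (iteratedDeriv k (fun y => V y t i j) x) ^ 2
          ≤ Real.exp (2 * (σ₀ / 2) * |x|) * (C * t * Real.exp (-σ₀ * |x|)) ^ 2 :=
            mul_le_mul_of_nonneg_left h2 (Real.exp_pos _).le
        _ = (Real.exp (2 * (σ₀ / 2) * |x|) * Real.exp (-σ₀ * |x|))
              * ((C * t) ^ 2 * Real.exp (-σ₀ * |x|)) := by ring
        _ = (C * t) ^ 2 * Real.exp (-σ₀ * |x|) := by rw [h3, one_mul]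
    have hsum : (∑ i : Fin 3, ∑ j : Fin 3, ∑ k ∈ Finset.range 5,
        ∫ x : ℝ, Real.exp (2 * (σ₀ / 2) * |x|) * (iteratedDeriv k (fun y => V y t i j) x) ^ 2)
        ≤ (45 * J) * (C * t) ^ 2 := by
      calc _ ≤ ∑ i : Fin 3, ∑ j : Fin 3, ∑ k ∈ Finset.range 5, (C * t) ^ 2 * J :=
            Finset.sum_le_sum fun i _ => Finset.sum_le_sum fun j _ =>
              Finset.sum_le_sum fun k hk => hI i j k hk
        _ = _ := by simp; ring
    refine (Real.sqrt_le_sqrt hsum).trans ?_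
    rw [Real.sqrt_mul (by positivity), Real.sqrt_sq (by positivity)]
    have : 0 ≤ C * t := by positivity
    nlinarith
  · intro x
    have h1 : ∀ i j : Fin 3, ∀ k ∈ Finset.range 4, |iteratedDeriv k (fun y => V y t i j) x|
        ≤ C * t * Real.exp (-(σ₀ / 2) * |x|) := by
      intro i j k hk
      refine (P i j k (by have := Finset.mem_range.1 hk; omega) x).trans ?_
      have : -σ₀ * |x| ≤ -(σ₀ / 2) * |x| := by nlinarith [abs_nonneg x]
      gcongr
    calc _ ≤ ∑ i : Fin 3, ∑ j : Fin 3, ∑ k ∈ Finset.range 4,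
            C * t * Real.exp (-(σ₀ / 2) * |x|) :=
          Finset.sum_le_sum fun i _ => Finset.sum_le_sum fun j _ =>
              Finset.sum_le_sum fun k hk => h1 i j k hk
      _ = 36 * C * t * Real.exp (-(σ₀ / 2) * |x|) := by simp; ring
      _ ≤ _ := by
          have : 0 ≤ Real.sqrt (45 * J) * C := by positivity
          gcongr
          linarith
end
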